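/- arXiv:2012.14014 — 2 statements merged into one kernel-verified Lean document; each statement's English description precedes it below -/
import Mathlib

section
/- Cayley–Hamilton identity for the standard Sp(2)-type RTT-algebra: Let W be an associative unital ℂ-algebra, q ∈ ℂ∖{0}, and let T¹₁, T¹₂, T²₁, T²₂ ∈ W satisfy the relations q² Tⁱ₂ Tⁱ₁ = Tⁱ₁ Tⁱ₂ and q² T²ᵢ T¹ᵢ = T¹ᵢ T²ᵢ for i = 1,2, [T²₁, T¹₂] = 0, and [T²₂, T¹₁] = (q^{−2} − q²) T¹₂ T²₁. Set a₁ := q^{−5} T¹₁ + q^{−1} T²₂ and g := q^{−6}(T¹₁ T²₂ − q² T¹₂ T²₁), and let φ(T) be the 2×2 matrix with entries φ(T)¹₁ = q^{−4} T¹₁ + (1 − q^{−4}) T²₂, φ(T)¹₂ = q^{−6} T¹₂, φ(T)²₁ = q^{−2} T²₁, φ(T)²₂ = T²₂. Then, with T the 2×2 matrix (Tⁱⱼ), one has the matrix identity T·φ(T) − q·T·a₁ + q²·g·I = 0 over W (a₁ and g multiplying entries on the right); moreover g commutes with each of T¹₁, T¹₂, T²₁, T²₂. -/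
noncomputable section

namespace QMA

/-- Multiply all entries of a matrix by `c` on the right. -/
def rmulE {A : Type*} [Mul A] {m : Type*} (X : Matrix m m A) (c : A) : Matrix m m A :=
  fun a b => X a b * c

/-- The 2-contraction, up to its scalar factor, commutes with the generators. -/
theorem commute_two_contraction {K W : Type*} [Field K] [Ring W] [Algebra K W] {p : K}
    (hp : p ≠ 0) {a b c d : W}
    (hab : a * b = p • (b * a)) (hcd : c * d = p • (d * c))
    (hac : a * c = p • (c * a)) (hbd : b * d = p • (d * b))
    (hbc : b * c = c * b) (had : a * d = d * a - (p⁻¹ - p) • (c * b)) :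
    Commute (a * d - p • (b * c)) a ∧ Commute (a * d - p • (b * c)) b ∧
      Commute (a * d - p • (b * c)) c ∧ Commute (a * d - p • (b * c)) d := by
  have left_mul {x y z : W} (h : x * y = z) (w : W) : x * (y * w) = z * w := by
    rw [← mul_assoc, h]
  have hcd' := left_mul hcd
  have hac' := left_mul hac
  have hbd' := left_mul hbd
  have hbc' := left_mul hbc
  have had' := left_mul had
  refine ⟨?_, ?_, ?_, ?_⟩ <;>
    simp only [Commute, SemiconjBy, mul_assoc, mul_sub, sub_mul, mul_smul_comm, smul_mul_assoc,
      hab, hac, hbd, hbc, had, hcd', hac', hbd', hbc', had'] <;>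
    match_scalars <;> field_simp <;> ring

/-- **Cayley–Hamilton identity for the standard `Sp(2)`-type RTT-algebra**
(eqs. (4.19), (4.20) of Ogievetsky–Pyatov).

If the entries of the `2×2` matrix `T` satisfy the RTT-relations of the standard
`Sp(2)`-type R-matrix then `T φ(T) - q T a₁ + q² g I = 0`, and the 2-contraction `g`
commutes with all the generators. -/
theorem sp2_rtt_cayley_hamilton
    {W : Type*} [Ring W] [Algebra ℂ W] (q : ℂ) (hq : q ≠ 0)
    (T11 T12 T21 T22 : W)
    (h1 : q ^ 2 • (T12 * T11) = T11 * T12)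
    (h2 : q ^ 2 • (T22 * T21) = T21 * T22)
    (h3 : q ^ 2 • (T21 * T11) = T11 * T21)
    (h4 : q ^ 2 • (T22 * T12) = T12 * T22)
    (h5 : T21 * T12 = T12 * T21)
    (h6 : T22 * T11 - T11 * T22 = (q ^ (-2 : ℤ) - q ^ 2) • (T12 * T21)) :
    (Matrix.of ![![T11, T12], ![T21, T22]] *
          Matrix.of
            ![![q ^ (-4 : ℤ) • T11 + (1 - q ^ (-4 : ℤ)) • T22, q ^ (-6 : ℤ) • T12],
              ![q ^ (-2 : ℤ) • T21, T22]] -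
        q • rmulE (Matrix.of ![![T11, T12], ![T21, T22]])
          (q ^ (-5 : ℤ) • T11 + q⁻¹ • T22) +
        q ^ 2 •
          (q ^ (-6 : ℤ) • (T11 * T22 - q ^ 2 • (T12 * T21))) •
            (1 : Matrix (Fin 2) (Fin 2) W) = 0) ∧
    Commute (q ^ (-6 : ℤ) • (T11 * T22 - q ^ 2 • (T12 * T21))) T11 ∧
    Commute (q ^ (-6 : ℤ) • (T11 * T22 - q ^ 2 • (T12 * T21))) T12 ∧
    Commute (q ^ (-6 : ℤ) • (T11 * T22 - q ^ 2 • (T12 * T21))) T21 ∧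
    Commute (q ^ (-6 : ℤ) • (T11 * T22 - q ^ 2 • (T12 * T21))) T22 := by
  have hp : q ^ 2 ≠ 0 := pow_ne_zero 2 hq
  have had : T11 * T22 = T22 * T11 - ((q ^ 2)⁻¹ - q ^ 2) • (T21 * T12) := by
    rw [h5, ← zpow_natCast, ← zpow_neg]
    exact eq_sub_of_add_eq' (sub_eq_iff_eq_add.mp h6).symm
  obtain ⟨ha, hb, hc, hd⟩ :=
    commute_two_contraction hp h1.symm h2.symm h3.symm h4.symm h5.symm had
  refine ⟨?_, ha.smul_left _, hb.smul_left _, hc.smul_left _, hd.smul_left _⟩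
  ext i j
  fin_cases i <;> fin_cases j <;>
    simp [rmulE, mul_add, had, ← h1, ← h2, ← h5] <;>
    match_scalars <;> field_simp <;> ring

end QMA

end
end

section
/- Cayley–Hamilton identity for the standard Sp(2)-type reflection equation algebra: Let W be an associative unital ℂ-algebra, q ∈ ℂ∖{0} with q⁴ ≠ 1 not required, and let L¹₁, L¹₂, L²₁, L²₂ ∈ W satisfy the relations Lⁱⱼ L¹₁ = q^{4(j−i)} L¹₁ Lⁱⱼ for all i,j ∈ {1,2}, [L²₂, L¹₂] = (1 − q^{−4}) L¹₁ L¹₂, [L²₂, L²₁] = −q^{−4}(1 − q^{−4}) L¹₁ L²₁, and [L²₁, L¹₂] = (1 − q^{−4}) L¹₁ (L¹₁ − L²₂). Set a₁ := q^{−5} L¹₁ + q^{−1} L²₂ and g := q^{−2}(L¹₁ L²₂ − (1 − q^{−4})(L¹₁)² − L¹₂ L²₁). Then, with L the 2×2 matrix (Lⁱⱼ), one has the matrix identity L² − q·L·a₁ + q²·g·I = 0 over W, where L² is the usual matrix square; moreover both g and a₁ commute with each of L¹₁, L¹₂, L²₁, L²₂. -/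
noncomputable section

namespace QMA

section Relations

variable {W : Type*} [Ring W] [Algebra ℂ W] {s : ℂ} {a b c d : W}

/-- The trace-like element `s⁻¹ a + d` is central. -/
theorem commute_trace (hs : s ≠ 0)
    (hba : b * a = s • (a * b)) (hca : c * a = s⁻¹ • (a * c)) (hda : d * a = a * d)
    (hdb : d * b - b * d = (1 - s⁻¹) • (a * b))
    (hdc : d * c - c * d = (-s⁻¹ * (1 - s⁻¹)) • (a * c)) :
    ∀ x ∈ ({a, b, c, d} : Set W), Commute (s⁻¹ • a + d) x := by
  rw [sub_eq_iff_eq_add] at hdb hdc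
  rintro x (rfl | rfl | rfl | rfl) <;>
    simp only [Commute, SemiconjBy, add_mul, mul_add, smul_mul_assoc, mul_smul_comm,
      hba, hca, hda, hdb, hdc] <;>
    match_scalars <;> field_simp <;> ring

/-- The determinant-like element `a d - (1 - s⁻¹) a² - b c` is central. -/
theorem commute_det (hs : s ≠ 0)
    (hba : b * a = s • (a * b)) (hca : c * a = s⁻¹ • (a * c)) (hda : d * a = a * d)
    (hdb : d * b - b * d = (1 - s⁻¹) • (a * b))
    (hdc : d * c - c * d = (-s⁻¹ * (1 - s⁻¹)) • (a * c))
    (hcb : c * b - b * c = (1 - s⁻¹) • (a * (a - d))) :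
    ∀ x ∈ ({a, b, c, d} : Set W),
      Commute (a * d - (1 - s⁻¹) • (a * a) - b * c) x := by
  rw [sub_eq_iff_eq_add] at hdb hdc hcb
  have hba' (e : W) : b * (a * e) = s • (a * (b * e)) := by
    simp only [← mul_assoc, hba, smul_mul_assoc]
  have hca' (e : W) : c * (a * e) = s⁻¹ • (a * (c * e)) := by
    simp only [← mul_assoc, hca, smul_mul_assoc]
  have hda' (e : W) : d * (a * e) = a * (d * e) := by
    simp only [← mul_assoc, hda]
  have hdb' (e : W) : d * (b * e) = (1 - s⁻¹) • (a * (b * e)) + b * (d * e) := by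
    simp only [← mul_assoc, hdb, add_mul, smul_mul_assoc]
  have hcb' (e : W) :
      c * (b * e) = (1 - s⁻¹) • (a * (a * e) - a * (d * e)) + b * (c * e) := by
    simp only [← mul_assoc, hcb, add_mul, smul_mul_assoc, mul_sub, sub_mul]
  rintro x (rfl | rfl | rfl | rfl) <;>
    simp only [Commute, SemiconjBy, mul_add, sub_mul, mul_sub, smul_mul_assoc,
      mul_smul_comm, smul_add, smul_sub, mul_assoc,
      hba, hca, hda, hdb, hdc, hcb, hba', hca', hda', hdb', hcb'] <;>
    match_scalars <;> field_simp <;> ring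

/-- The Cayley–Hamilton identity in terms of the trace-like and determinant-like elements. -/
theorem sq_sub_rmulE_add_smul_one (hs : s ≠ 0)
    (hba : b * a = s • (a * b)) (hca : c * a = s⁻¹ • (a * c)) (hda : d * a = a * d)
    (hdc : d * c - c * d = (-s⁻¹ * (1 - s⁻¹)) • (a * c))
    (hcb : c * b - b * c = (1 - s⁻¹) • (a * (a - d))) :
    Matrix.of ![![a, b], ![c, d]] * Matrix.of ![![a, b], ![c, d]] -
        rmulE (Matrix.of ![![a, b], ![c, d]]) (s⁻¹ • a + d) +
      (a * d - (1 - s⁻¹) • (a * a) - b * c) • (1 : Matrix (Fin 2) (Fin 2) W) = 0 := by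
  rw [sub_eq_iff_eq_add] at hdc hcb
  ext i j
  fin_cases i <;> fin_cases j <;>
    simp [rmulE, mul_add, mul_sub,
      hba, hca, hda, hdc, hcb, -neg_smul] <;>
    match_scalars <;> field_simp <;> ring

end Relations

/-- **Cayley–Hamilton identity for the standard `Sp(2)`-type reflection equation algebra**
(eq. (4.24) of Ogievetsky–Pyatov).

If the entries of the `2×2` matrix `L` satisfy the reflection-equation relations of the
standard `Sp(2)`-type R-matrix then `L² - q L a₁ + q² g I = 0`, and both `g` and `a₁`
are central. -/
theorem sp2_re_cayley_hamilton
    {W : Type*} [Ring W] [Algebra ℂ W] (q : ℂ) (hq : q ≠ 0)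
    (L11 L12 L21 L22 : W)
    (h1 : ∀ i j : Fin 2,
      Matrix.of ![![L11, L12], ![L21, L22]] i j * L11 =
        q ^ (4 * ((j : ℤ) - (i : ℤ))) • (L11 * Matrix.of ![![L11, L12], ![L21, L22]] i j))
    (h2 : L22 * L12 - L12 * L22 = (1 - q ^ (-4 : ℤ)) • (L11 * L12))
    (h3 : L22 * L21 - L21 * L22 = (-q ^ (-4 : ℤ) * (1 - q ^ (-4 : ℤ))) • (L11 * L21))
    (h4 : L21 * L12 - L12 * L21 = (1 - q ^ (-4 : ℤ)) • (L11 * (L11 - L22))) :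
    (Matrix.of ![![L11, L12], ![L21, L22]] * Matrix.of ![![L11, L12], ![L21, L22]] -
        q • rmulE (Matrix.of ![![L11, L12], ![L21, L22]])
          (q ^ (-5 : ℤ) • L11 + q⁻¹ • L22) +
        q ^ 2 •
          (q ^ (-2 : ℤ) •
              (L11 * L22 - (1 - q ^ (-4 : ℤ)) • (L11 * L11) - L12 * L21)) •
            (1 : Matrix (Fin 2) (Fin 2) W) = 0) ∧
    (∀ x ∈ ({L11, L12, L21, L22} : Set W),
      Commute (q ^ (-2 : ℤ) • (L11 * L22 - (1 - q ^ (-4 : ℤ)) • (L11 * L11) - L12 * L21)) x ∧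
      Commute (q ^ (-5 : ℤ) • L11 + q⁻¹ • L22) x) := by
  have hs : q ^ 4 ≠ 0 := pow_ne_zero 4 hq
  have hinv : q ^ (-4 : ℤ) = (q ^ 4)⁻¹ := by rw [zpow_neg]; norm_cast
  have hba : L12 * L11 = q ^ 4 • (L11 * L12) := by
    simpa using h1 0 1
  have hca : L21 * L11 = (q ^ 4)⁻¹ • (L11 * L21) := by
    simpa [hinv] using h1 1 0
  have hda : L22 * L11 = L11 * L22 := by
    simpa using h1 1 1
  rw [hinv] at h2 h3 h4 ⊢
  have htr : q ^ (-5 : ℤ) • L11 + q⁻¹ • L22 = q⁻¹ • ((q ^ 4)⁻¹ • L11 + L22) := by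
    match_scalars <;> field_simp
  rw [htr]
  refine ⟨?_, fun x hx =>
    ⟨(commute_det hs hba hca hda h2 h3 h4 x hx).smul_left _,
      (commute_trace hs hba hca hda h2 h3 x hx).smul_left _⟩⟩
  have hmul (X : Matrix (Fin 2) (Fin 2) W) (z : W) : q • rmulE X (q⁻¹ • z) = rmulE X z := by
    ext i j
    simp [rmulE, smul_smul, hq]
  have hdet (z : W) : q ^ 2 • (q ^ (-2 : ℤ) • z) • (1 : Matrix (Fin 2) (Fin 2) W) = z • 1 := by
    rw [← smul_assoc, smul_smul, zpow_neg, zpow_ofNat, mul_inv_cancel₀ (pow_ne_zero 2 hq),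
      one_smul]
  rw [hmul, hdet]
  exact sq_sub_rmulE_add_smul_one hs hba hca hda h3 h4

end QMA

end
end
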